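/- Consider a non-stationary K-armed bandit satisfying Assumption A2 with constants θ, ξ, η, run with the UCB-ERM algorithm with parameter α, where 1/2 ≤ η < 1, ξ > 1 is large enough that there exists α > 2 with ξη(1−η) ≤ α < ξ(1−η). Let ρ̄_n = (1/n) Σ_{i=1}^K T_i(n) ρ̂_{i,T_i(n)}. Then, setting η' = α/(ξ(1−η)) and ξ' = α − 1, there exists a constant θ' > 1 (depending on R, K, Δ_min, β, θ, ξ, α, η) such that for every n ∈ ℕ and every z ≥ 1: P[n ρ̄_n − n μ* ≥ n^{η'} z] ≤ θ'/z^{ξ'} and P[n ρ̄_n − n μ* ≤ −n^{η'} z] ≤ θ'/z^{ξ'}; moreover 1/2 ≤ η' < 1 and ξ' > 1. -/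

import Mathlib

open MeasureTheory ProbabilityTheory Filter

/-- The empirical ERM_β estimator `ρ̂_n = (1/β) ln((1/n) Σ_{t<n} exp(β x_t))` (the sum runs
over the first `n` samples). -/
noncomputable def ermEst (β : ℝ) (n : ℕ) (x : ℕ → ℝ) : ℝ :=
  (1 / β) * Real.log ((1 / (n : ℝ)) * ∑ t ∈ Finset.range n, Real.exp (β * x t))

/-- The UCB exploration bonus `b_{t,s} = θ^{1/ξ} t^{α/ξ} / s^{1−η}`. -/
noncomputable def bonus (θ ξ η α : ℝ) (t s : ℕ) : ℝ :=
  θ ^ (1 / ξ) * (t : ℝ) ^ (α / ξ) / (s : ℝ) ^ (1 - η)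

/-- `pulls a i t ω` : the number of pulls `T_i(t)` of arm `i` up to and including round `t`
(rounds are indexed `1, 2, …`). -/
def pulls {Ω : Type*} {K : ℕ} (a : ℕ → Ω → Fin K) (i : Fin K) (t : ℕ) (ω : Ω) : ℕ :=
  ((Finset.Icc 1 t).filter fun s => a s ω = i).card

lemma pulls_zero {Ω : Type*} {K : ℕ} (a : ℕ → Ω → Fin K) (i : Fin K) (ω : Ω) :
    pulls a i 0 ω = 0 := by
  simp [pulls]

lemma pulls_succ {Ω : Type*} {K : ℕ} (a : ℕ → Ω → Fin K) (i : Fin K) (t : ℕ) (ω : Ω) :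
    pulls a i (t + 1) ω = pulls a i t ω + if a (t + 1) ω = i then 1 else 0 := by
  unfold pulls
  rw [← Finset.insert_Icc_right_eq_Icc_add_one (by omega), Finset.filter_insert]
  split_ifs with h
  · rw [Finset.card_insert_of_notMem (by simp)]
  · rfl

lemma sum_pulls {Ω : Type*} {K : ℕ} (a : ℕ → Ω → Fin K) (t : ℕ) (ω : Ω) :
    ∑ i, pulls a i t ω = t := by
  induction t with
  | zero => simp [pulls_zero]
  | succ t ih => simp [pulls_succ, Finset.sum_add_distrib, ih]

lemma exists_pulls_pred_eq {Ω : Type*} {K : ℕ} (a : ℕ → Ω → Fin K) (i : Fin K) (n u : ℕ)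
    (ω : Ω) (h : u < pulls a i n ω) :
    ∃ t, t < n ∧ a (t + 1) ω = i ∧ pulls a i t ω = u := by
  induction n with
  | zero => simp [pulls_zero] at h
  | succ n ih =>
    by_cases hu : u < pulls a i n ω
    · obtain ⟨t, ht, h1, h2⟩ := ih hu
      exact ⟨t, by omega, h1, h2⟩
    · rw [pulls_succ] at h
      split_ifs at h with hi
      · exact ⟨n, by omega, hi, by omega⟩
      · omega

lemma pulls_pos_iff {Ω : Type*} {K : ℕ} (a : ℕ → Ω → Fin K) (i : Fin K) (t : ℕ) (ω : Ω) :
    0 < pulls a i t ω ↔ ∃ s, 1 ≤ s ∧ s ≤ t ∧ a s ω = i := by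
  simp [pulls, Finset.card_pos, Finset.Nonempty, and_assoc]

lemma pulls_add_pulls_le {Ω : Type*} {K : ℕ} (a : ℕ → Ω → Fin K) {i j : Fin K} (hij : i ≠ j)
    (t : ℕ) (ω : Ω) : pulls a i t ω + pulls a j t ω ≤ t := by
  have h := Finset.sum_le_sum_of_subset (f := fun k => pulls a k t ω)
    (Finset.subset_univ ({i, j} : Finset (Fin K)))
  rwa [sum_pulls, Finset.sum_pair hij] at h

lemma bonus_mono {θ ξ η α : ℝ} (hθ : 0 ≤ θ) (hξ : 0 ≤ ξ) (hα : 0 ≤ α) {t t' : ℕ} (h : t ≤ t')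
    (s : ℕ) : bonus θ ξ η α t s ≤ bonus θ ξ η α t' s := by
  unfold bonus
  have : (t : ℝ) ≤ t' := by exact_mod_cast h
  gcongr

/-- If a suboptimal arm is pulled more than `u` times, where `u` is large enough for its bonus to be
at most half its gap, then either its own estimator or an estimator of the optimal arm deviates
by more than its bonus. -/
lemma deviation_of_lt_pulls {Ω : Type*} {K : ℕ} {β : ℝ} {x : Fin K → ℕ → Ω → ℝ}
    {θ ξ η α : ℝ} (hθ : 0 ≤ θ) (hξ : 0 ≤ ξ) (hα : 0 ≤ α) {a : ℕ → Ω → Fin K} {ω : Ω}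
    (hinit : ∀ t, 1 ≤ t → t ≤ K → ((a t ω : ℕ) = t - 1))
    (hsel : ∀ t, K < t → ∀ i : Fin K,
      ermEst β (pulls a (a t ω) (t - 1) ω) (fun u => x (a t ω) u ω)
          - bonus θ ξ η α t (pulls a (a t ω) (t - 1) ω)
        ≤ ermEst β (pulls a i (t - 1) ω) (fun u => x i u ω)
          - bonus θ ξ η α t (pulls a i (t - 1) ω))
    {i j : Fin K} (hij : i ≠ j) {n u : ℕ} (hu : 1 ≤ u) (hlt : u < pulls a i n ω) {p q : ℝ}
    (hgap : 2 * bonus θ ξ η α n u ≤ p - q) :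
    ermEst β u (fun k => x i k ω) ≤ p - bonus θ ξ η α u u ∨
      ∃ s ∈ Finset.Icc 1 n, q + bonus θ ξ η α (u + s) s ≤ ermEst β s (fun k => x j k ω) := by
  obtain ⟨t, htn, hat, htu⟩ := exists_pulls_pred_eq a i n u ω hlt
  have hKt : K < t + 1 := by
    by_contra! hcon
    obtain ⟨s, hs1, hst, has⟩ := (pulls_pos_iff a i t ω).1 (by omega)
    have h1 := hinit (t + 1) (by omega) hcon
    have h2 := hinit s hs1 (by omega)
    rw [hat] at h1
    rw [has] at h2
    omega
  have hs : 0 < pulls a j t ω := by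
    refine (pulls_pos_iff a j t ω).2 ⟨j + 1, by omega, by omega, Fin.ext ?_⟩
    rw [hinit (j + 1) (by omega) (by omega)]
    rfl
  have hadd := pulls_add_pulls_le a hij t ω
  have hsel' := hsel (t + 1) hKt j
  rw [hat, Nat.add_sub_cancel, htu] at hsel'
  by_contra! hcon
  obtain ⟨h1, h2⟩ := hcon
  have h3 := h2 (pulls a j t ω) (Finset.mem_Icc.2 ⟨hs, by omega⟩)
  have b1 : bonus θ ξ η α u u ≤ bonus θ ξ η α n u := bonus_mono hθ hξ hα (by omega) u
  have b2 : bonus θ ξ η α (t + 1) u ≤ bonus θ ξ η α n u := bonus_mono hθ hξ hα (by omega) u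
  have b3 : bonus θ ξ η α (u + pulls a j t ω) (pulls a j t ω)
      ≤ bonus θ ξ η α (t + 1) (pulls a j t ω) := bonus_mono hθ hξ hα (by omega) _
  linarith

lemma natCast_mul_bonus {θ ξ η α : ℝ} {t s : ℕ} (hs : 1 ≤ s) :
    (s : ℝ) * bonus θ ξ η α t s = (s : ℝ) ^ η * (θ ^ (1 / ξ) * (t : ℝ) ^ (α / ξ)) := by
  have hs0 : (0 : ℝ) < s := by exact_mod_cast hs
  have h : (s : ℝ) = (s : ℝ) ^ η * (s : ℝ) ^ (1 - η) := by
    rw [← Real.rpow_add hs0]; simp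
  have h' : (0 : ℝ) < (s : ℝ) ^ (1 - η) := by positivity
  unfold bonus
  nth_rewrite 1 [h]
  field_simp

lemma one_le_bonus_numerator {θ ξ α : ℝ} (hθ : 1 ≤ θ) (hξ : 0 < ξ) (hα : 0 ≤ α) {t : ℕ}
    (ht : 1 ≤ t) : 1 ≤ θ ^ (1 / ξ) * (t : ℝ) ^ (α / ξ) :=
  one_le_mul_of_one_le_of_one_le (Real.one_le_rpow hθ (by positivity))
    (Real.one_le_rpow (by exact_mod_cast ht) (by positivity))

lemma div_bonus_numerator_rpow {θ ξ α : ℝ} (hθ : 0 < θ) (hξ : 0 < ξ) (t : ℕ) :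
    θ / (θ ^ (1 / ξ) * (t : ℝ) ^ (α / ξ)) ^ ξ = 1 / (t : ℝ) ^ α := by
  rw [Real.mul_rpow (by positivity) (by positivity), ← Real.rpow_mul hθ.le,
    ← Real.rpow_mul (by positivity), one_div_mul_cancel hξ.ne', div_mul_cancel₀ _ hξ.ne',
    Real.rpow_one, div_mul_eq_div_div, div_self hθ.ne']

lemma sum_one_div_add_sq_le {u : ℕ} (hu : 1 ≤ u) (n : ℕ) :
    ∑ s ∈ Finset.Icc 1 n, 1 / ((u + s : ℕ) : ℝ) ^ 2 ≤ 1 / (u : ℝ) - 1 / ((u + n : ℕ) : ℝ) := by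
  have hu0 : (0 : ℝ) < u := by exact_mod_cast hu
  induction n with
  | zero => simp
  | succ n ih =>
    rw [Finset.sum_Icc_succ_top (by omega)]
    have h : 1 / ((u + (n + 1) : ℕ) : ℝ) ^ 2
        ≤ 1 / ((u + n : ℕ) : ℝ) - 1 / ((u + (n + 1) : ℕ) : ℝ) := by
      push_cast
      have h1 : (0 : ℝ) < u + n := by positivity
      rw [div_sub_div _ _ (by positivity) (by positivity),
        div_le_div_iff₀ (by positivity) (by positivity)]
      nlinarith
    linarith

lemma sum_one_div_add_rpow_le {α : ℝ} (hα : 2 ≤ α) {u : ℕ} (hu : 1 ≤ u) (n : ℕ) :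
    ∑ s ∈ Finset.Icc 1 n, 1 / ((u + s : ℕ) : ℝ) ^ α ≤ 1 / (u : ℝ) ^ (α - 1) := by
  have hu0 : (0 : ℝ) < u := by exact_mod_cast hu
  have h : ∀ s ∈ Finset.Icc 1 n, 1 / ((u + s : ℕ) : ℝ) ^ α
      ≤ 1 / (u : ℝ) ^ (α - 2) * (1 / ((u + s : ℕ) : ℝ) ^ 2) := by
    intro s _
    have hus : (0 : ℝ) < ((u + s : ℕ) : ℝ) := by positivity
    have e : ((u + s : ℕ) : ℝ) ^ α = ((u + s : ℕ) : ℝ) ^ (α - 2) * ((u + s : ℕ) : ℝ) ^ 2 := by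
      rw [← Real.rpow_natCast, ← Real.rpow_add hus]; norm_num
    rw [e, one_div_mul_one_div]
    have h2 : (u : ℝ) ≤ ((u + s : ℕ) : ℝ) := by push_cast; linarith [Nat.cast_nonneg (α := ℝ) s]
    have h3 : (u : ℝ) ^ (α - 2) ≤ ((u + s : ℕ) : ℝ) ^ (α - 2) :=
      Real.rpow_le_rpow hu0.le h2 (by linarith)
    gcongr
  have e : (u : ℝ) ^ (α - 1) = (u : ℝ) ^ (α - 2) * u := by
    rw [← Real.rpow_add_one hu0.ne']; ring_nf
  calc _ ≤ ∑ s ∈ Finset.Icc 1 n, 1 / (u : ℝ) ^ (α - 2) * (1 / ((u + s : ℕ) : ℝ) ^ 2) :=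
        Finset.sum_le_sum h
    _ = 1 / (u : ℝ) ^ (α - 2) * ∑ s ∈ Finset.Icc 1 n, 1 / ((u + s : ℕ) : ℝ) ^ 2 := by
        rw [Finset.mul_sum]
    _ ≤ 1 / (u : ℝ) ^ (α - 2) * (1 / (u : ℝ)) := by
        gcongr
        have := sum_one_div_add_sq_le hu n
        have h0 : (0 : ℝ) ≤ 1 / ((u + n : ℕ) : ℝ) := by positivity
        linarith
    _ = 1 / (u : ℝ) ^ (α - 1) := by rw [e, one_div_mul_one_div]

/-- Polynomial tail of the number of pulls of a suboptimal arm. -/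
lemma measure_lt_pulls_le {Ω : Type*} [MeasurableSpace Ω] {P : Measure Ω}
    {K : ℕ} {β : ℝ} {x : Fin K → ℕ → Ω → ℝ}
    {θ ξ η α : ℝ} (hθ : 1 < θ) (hξ : 1 < ξ) (hα2 : 2 < α) {μ : Fin K → ℝ}
    (hconcU : ∀ i, ∀ n : ℕ, 1 ≤ n → ∀ z : ℝ, 1 ≤ z →
      P {ω | (n : ℝ) ^ η * z ≤ (n : ℝ) * ermEst β n (fun t => x i t ω) - (n : ℝ) * μ i}
        ≤ ENNReal.ofReal (θ / z ^ ξ))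
    (hconcL : ∀ i, ∀ n : ℕ, 1 ≤ n → ∀ z : ℝ, 1 ≤ z →
      P {ω | (n : ℝ) * ermEst β n (fun t => x i t ω) - (n : ℝ) * μ i ≤ -((n : ℝ) ^ η * z)}
        ≤ ENNReal.ofReal (θ / z ^ ξ))
    {a : ℕ → Ω → Fin K}
    (hinit : ∀ ω, ∀ t, 1 ≤ t → t ≤ K → ((a t ω : ℕ) = t - 1))
    (hsel : ∀ ω, ∀ t, K < t → ∀ i : Fin K,
      ermEst β (pulls a (a t ω) (t - 1) ω) (fun u => x (a t ω) u ω)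
          - bonus θ ξ η α t (pulls a (a t ω) (t - 1) ω)
        ≤ ermEst β (pulls a i (t - 1) ω) (fun u => x i u ω)
          - bonus θ ξ η α t (pulls a i (t - 1) ω))
    {i j : Fin K} (hij : i ≠ j) {n u : ℕ} (hu : 1 ≤ u)
    (hgap : 2 * bonus θ ξ η α n u ≤ μ i - μ j) :
    P {ω | u < pulls a i n ω} ≤ ENNReal.ofReal (2 / (u : ℝ) ^ (α - 1)) := by
  have hu1 : (1 : ℝ) ≤ u := by exact_mod_cast hu
  have hsub : {ω | u < pulls a i n ω} ⊆
      {ω | ermEst β u (fun k => x i k ω) ≤ μ i - bonus θ ξ η α u u} ∪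
        ⋃ s ∈ Finset.Icc 1 n,
          {ω | μ j + bonus θ ξ η α (u + s) s ≤ ermEst β s (fun k => x j k ω)} := by
    intro ω hω
    rcases deviation_of_lt_pulls (by linarith) (by linarith) (by linarith) (hinit ω) (hsel ω) hij
      hu hω hgap with h | ⟨s, hs, h⟩
    · exact Or.inl h
    · exact Or.inr (Set.mem_biUnion hs h)
  have h1 : P {ω | ermEst β u (fun k => x i k ω) ≤ μ i - bonus θ ξ η α u u}
      ≤ ENNReal.ofReal (1 / (u : ℝ) ^ α) := by
    rw [← div_bonus_numerator_rpow (by linarith : 0 < θ) (by linarith : 0 < ξ)]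
    refine (measure_mono fun ω hω => ?_).trans (hconcL i u hu _
      (one_le_bonus_numerator hθ.le (by linarith) (by linarith) hu))
    simp only [Set.mem_ofPred_eq] at hω ⊢
    rw [← natCast_mul_bonus hu]
    nlinarith
  have h2 : ∀ s ∈ Finset.Icc 1 n,
      P {ω | μ j + bonus θ ξ η α (u + s) s ≤ ermEst β s (fun k => x j k ω)}
        ≤ ENNReal.ofReal (1 / ((u + s : ℕ) : ℝ) ^ α) := by
    intro s hs
    have hs1 := (Finset.mem_Icc.1 hs).1
    have hs0 : (0 : ℝ) ≤ s := by positivity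
    rw [← div_bonus_numerator_rpow (by linarith : 0 < θ) (by linarith : 0 < ξ)]
    refine (measure_mono fun ω hω => ?_).trans (hconcU j s hs1 _
      (one_le_bonus_numerator hθ.le (by linarith) (by linarith) (by omega)))
    simp only [Set.mem_ofPred_eq] at hω ⊢
    rw [← natCast_mul_bonus hs1]
    nlinarith
  have h3 : 1 / (u : ℝ) ^ α ≤ 1 / (u : ℝ) ^ (α - 1) := by
    have := Real.rpow_le_rpow_of_exponent_le hu1 (by linarith : α - 1 ≤ α)
    gcongr
  calc _ ≤ _ := measure_mono hsub
    _ ≤ _ := measure_union_le _ _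
    _ ≤ ENNReal.ofReal (1 / (u : ℝ) ^ α) +
        ∑ s ∈ Finset.Icc 1 n, ENNReal.ofReal (1 / ((u + s : ℕ) : ℝ) ^ α) :=
      add_le_add h1 ((measure_biUnion_finset_le _ _).trans (Finset.sum_le_sum h2))
    _ = ENNReal.ofReal (1 / (u : ℝ) ^ α +
        ∑ s ∈ Finset.Icc 1 n, 1 / ((u + s : ℕ) : ℝ) ^ α) := by
      rw [← ENNReal.ofReal_sum_of_nonneg (fun s _ => by positivity),
        ← ENNReal.ofReal_add (by positivity) (Finset.sum_nonneg fun s _ => by positivity)]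
    _ ≤ _ := by
      apply ENNReal.ofReal_le_ofReal
      have := sum_one_div_add_rpow_le hα2.le hu n
      have e : 2 / (u : ℝ) ^ (α - 1) = 1 / (u : ℝ) ^ (α - 1) + 1 / (u : ℝ) ^ (α - 1) := by ring
      linarith

lemma abs_ermEst_le {R β : ℝ} (hR : 0 ≤ R) (hβ : 0 < β) {x : ℕ → ℝ}
    (hx : ∀ t, x t ∈ Set.Icc (-R) R) (n : ℕ) : |ermEst β n x| ≤ R := by
  rcases Nat.eq_zero_or_pos n with rfl | hn
  · simpa [ermEst] using hR
  have hn0 : (0 : ℝ) < n := by exact_mod_cast hn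
  have hlo : Real.exp (β * -R) ≤ 1 / (n : ℝ) * ∑ t ∈ Finset.range n, Real.exp (β * x t) := by
    have h := Finset.card_nsmul_le_sum (Finset.range n) (fun t => Real.exp (β * x t))
      (Real.exp (β * -R)) fun t _ => Real.exp_le_exp.2 (by have := (hx t).1; gcongr)
    rw [Finset.card_range, nsmul_eq_mul] at h
    rw [one_div_mul_eq_div, le_div_iff₀ hn0]
    linarith
  have hhi : 1 / (n : ℝ) * ∑ t ∈ Finset.range n, Real.exp (β * x t) ≤ Real.exp (β * R) := by
    have h := Finset.sum_le_card_nsmul (Finset.range n) (fun t => Real.exp (β * x t))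
      (Real.exp (β * R)) fun t _ => Real.exp_le_exp.2 (by have := (hx t).2; gcongr)
    rw [Finset.card_range, nsmul_eq_mul] at h
    rw [one_div_mul_eq_div, div_le_iff₀ hn0]
    linarith
  have hpos := (Real.exp_pos _).trans_le hlo
  have h1 := (Real.le_log_iff_exp_le hpos).2 hlo
  have h2 := (Real.log_le_iff_le_exp hpos).2 hhi
  unfold ermEst
  rw [one_div_mul_eq_div β, abs_le, le_div_iff₀ hβ, div_le_iff₀ hβ]
  constructor <;> linarith

lemma abs_succ_mul_ermEst_sub_le {R β : ℝ} (hR : 0 ≤ R) (hβ : 0 < β) {x : ℕ → ℝ}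
    (hx : ∀ t, x t ∈ Set.Icc (-R) R) (n : ℕ) :
    |((n + 1 : ℕ) : ℝ) * ermEst β (n + 1) x - (n : ℝ) * ermEst β n x|
      ≤ R + Real.exp (2 * (β * R)) / β := by
  have hb := abs_ermEst_le hR hβ hx (n + 1)
  rcases Nat.eq_zero_or_pos n with rfl | hn
  · have : 0 ≤ Real.exp (2 * (β * R)) / β := by positivity
    simp only [zero_add, Nat.cast_one, one_mul, Nat.cast_zero, zero_mul, sub_zero] at hb ⊢
    linarith
  have hn0 : (0 : ℝ) < n := by exact_mod_cast hn
  set S := ∑ t ∈ Finset.range n, Real.exp (β * x t) with hS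
  set e := Real.exp (β * x n) with he
  have hSlo : n * Real.exp (β * -R) ≤ S := by
    have h := Finset.card_nsmul_le_sum (Finset.range n) (fun t => Real.exp (β * x t))
      (Real.exp (β * -R)) fun t _ => Real.exp_le_exp.2 (by have := (hx t).1; gcongr)
    rwa [Finset.card_range, nsmul_eq_mul] at h
  have hS0 : 0 < S := lt_of_lt_of_le (by positivity) hSlo
  have he0 : 0 < e := Real.exp_pos _
  have hratio : n * (e / S) ≤ Real.exp (2 * (β * R)) := by
    rw [mul_div_assoc', div_le_iff₀ hS0]
    have h1 : e ≤ Real.exp (β * R) := Real.exp_le_exp.2 (by have := (hx n).2; gcongr)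
    calc n * e ≤ n * Real.exp (β * R) := by gcongr
      _ = Real.exp (2 * (β * R)) * (n * Real.exp (β * -R)) := by
        rw [mul_left_comm, ← Real.exp_add]; ring_nf
      _ ≤ _ := by gcongr
  have hlogS0 : 0 ≤ Real.log (1 + e / S) := Real.log_nonneg (by have := div_pos he0 hS0; linarith)
  have hlogS1 : Real.log (1 + e / S) ≤ e / S := by
    have := Real.log_le_sub_one_of_pos (x := 1 + e / S) (by positivity); linarith
  have hlogn0 : 0 ≤ Real.log (1 + 1 / (n : ℝ)) :=
    Real.log_nonneg (by have := one_div_pos.2 hn0; linarith)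
  have hlogn1 : Real.log (1 + 1 / (n : ℝ)) ≤ 1 / n := by
    have := Real.log_le_sub_one_of_pos (x := 1 + 1 / (n : ℝ)) (by positivity); linarith
  have hdiff : ermEst β (n + 1) x - ermEst β n x
      = (Real.log (1 + e / S) - Real.log (1 + 1 / (n : ℝ))) / β := by
    have e1 : 1 + e / S = (S + e) / S := by field_simp
    have e2 : 1 + 1 / (n : ℝ) = (n + 1) / n := by field_simp
    unfold ermEst
    rw [Finset.sum_range_succ, ← hS, ← he, e1, e2, one_div_mul_eq_div, one_div_mul_eq_div,
      one_div_mul_eq_div, one_div_mul_eq_div, Real.log_div (by positivity) (by positivity),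
      Real.log_div (by positivity) (by positivity), Real.log_div (by positivity) (by positivity),
      Real.log_div (by positivity) (by positivity)]
    push_cast
    ring
  have hE : 1 ≤ Real.exp (2 * (β * R)) := Real.one_le_exp (by positivity)
  have hmul : |n * (ermEst β (n + 1) x - ermEst β n x)| ≤ Real.exp (2 * (β * R)) / β := by
    have h1 : n * Real.log (1 + e / S) ≤ n * (e / S) := by gcongr
    have h2 : n * Real.log (1 + 1 / (n : ℝ)) ≤ n * (1 / n) := by gcongr
    have h3 : (n : ℝ) * (1 / n) = 1 := by field_simp
    have h4 : 0 ≤ n * Real.log (1 + e / S) := by positivity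
    have h5 : 0 ≤ n * Real.log (1 + 1 / (n : ℝ)) := by positivity
    rw [hdiff, mul_div_assoc', abs_div, abs_of_pos hβ]
    gcongr
    rw [mul_sub, abs_le]
    constructor <;> linarith
  have hsplit : ((n + 1 : ℕ) : ℝ) * ermEst β (n + 1) x - (n : ℝ) * ermEst β n x
      = ermEst β (n + 1) x + n * (ermEst β (n + 1) x - ermEst β n x) := by
    push_cast; ring
  rw [hsplit]
  exact (abs_add_le _ _).trans (add_le_add hb hmul)

lemma abs_mul_ermEst_sub_le {R β : ℝ} (hR : 0 ≤ R) (hβ : 0 < β) {x : ℕ → ℝ}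
    (hx : ∀ t, x t ∈ Set.Icc (-R) R) (m k : ℕ) :
    |((m + k : ℕ) : ℝ) * ermEst β (m + k) x - (m : ℝ) * ermEst β m x|
      ≤ (R + Real.exp (2 * (β * R)) / β) * k := by
  induction k with
  | zero => simp
  | succ k ih =>
    have h := abs_succ_mul_ermEst_sub_le hR hβ hx (m + k)
    have h' := (abs_sub_le _ _ _).trans (add_le_add h ih)
    refine h'.trans_eq ?_
    push_cast
    ring

/-- Replacing all pulls by pulls of arm `j` changes the aggregate by at most a constant times the
number of pulls of the other arms. -/
lemma abs_sum_pulls_mul_ermEst_sub_le {Ω : Type*} {K : ℕ} {R β : ℝ} (hR : 0 ≤ R) (hβ : 0 < β)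
    {x : Fin K → ℕ → Ω → ℝ} {ω : Ω} (hx : ∀ i t, x i t ω ∈ Set.Icc (-R) R)
    (a : ℕ → Ω → Fin K) (j : Fin K) (n : ℕ) :
    |∑ i, (pulls a i n ω : ℝ) * ermEst β (pulls a i n ω) (fun t => x i t ω)
        - (n : ℝ) * ermEst β n (fun t => x j t ω)|
      ≤ (2 * R + Real.exp (2 * (β * R)) / β) *
        ∑ i ∈ Finset.univ.erase j, (pulls a i n ω : ℝ) := by
  have hn : n = pulls a j n ω + ∑ i ∈ Finset.univ.erase j, pulls a i n ω := by
    rw [Finset.add_sum_erase _ (fun i => pulls a i n ω) (Finset.mem_univ j), sum_pulls]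
  have h1 := abs_mul_ermEst_sub_le hR hβ (hx j) (pulls a j n ω)
    (∑ i ∈ Finset.univ.erase j, pulls a i n ω)
  rw [← hn, abs_sub_comm] at h1
  have h2 : |∑ i ∈ Finset.univ.erase j,
      (pulls a i n ω : ℝ) * ermEst β (pulls a i n ω) (fun t => x i t ω)|
        ≤ R * ∑ i ∈ Finset.univ.erase j, (pulls a i n ω : ℝ) := by
    rw [Finset.mul_sum]
    refine (Finset.abs_sum_le_sum_abs _ _).trans (Finset.sum_le_sum fun i _ => ?_)
    rw [abs_mul, Nat.abs_cast, mul_comm]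
    have := abs_ermEst_le hR hβ (hx i) (pulls a i n ω)
    gcongr
  rw [← Finset.add_sum_erase _ _ (Finset.mem_univ j), add_sub_right_comm]
  refine ((abs_add_le _ _).trans (add_le_add h1 h2)).trans_eq ?_
  push_cast
  ring

lemma two_mul_bonus_le {θ ξ η α Δ : ℝ} (hθ : 0 < θ) (hξ : 0 < ξ) (hη1 : η < 1) (hΔ : 0 < Δ)
    {n u : ℕ} (hn : 1 ≤ n)
    (hu : (2 * θ ^ (1 / ξ) / Δ) ^ (1 / (1 - η)) * (n : ℝ) ^ (α / (ξ * (1 - η))) ≤ u) :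
    2 * bonus θ ξ η α n u ≤ Δ := by
  have hγ : 0 < 1 - η := by linarith
  have hn0 : (0 : ℝ) < n := by exact_mod_cast hn
  have h := Real.rpow_le_rpow (by positivity) hu hγ.le
  rw [Real.mul_rpow (by positivity) (by positivity), ← Real.rpow_mul (by positivity),
    ← Real.rpow_mul hn0.le, one_div_mul_cancel hγ.ne', Real.rpow_one] at h
  have e : α / (ξ * (1 - η)) * (1 - η) = α / ξ := by field_simp
  rw [e, div_mul_eq_mul_div, div_le_iff₀ hΔ] at h
  have hpos : 0 < 2 * θ ^ (1 / ξ) * (n : ℝ) ^ (α / ξ) := by positivity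
  have hu0 : 0 < (u : ℝ) ^ (1 - η) := pos_of_mul_pos_left (hpos.trans_le h) hΔ.le
  unfold bonus
  rw [mul_div_assoc', div_le_iff₀ hu0]
  linarith

/-- Two-sided polynomial concentration of the aggregate with an explicit constant. -/
lemma measure_le_abs_sum_sub_le {Ω : Type*} [MeasurableSpace Ω] {P : Measure Ω}
    {K : ℕ} {R β : ℝ} (hR : 0 < R) (hβ : 0 < β) {x : Fin K → ℕ → Ω → ℝ}
    (hxbdd : ∀ i t ω, x i t ω ∈ Set.Icc (-R) R)
    {θ ξ η α : ℝ} (hθ : 1 < θ) (hξ : 1 < ξ) (hη1 : η < 1) (hα2 : 2 < α)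
    (hη' : η ≤ α / (ξ * (1 - η))) (hη'0 : 0 ≤ α / (ξ * (1 - η))) (hαξ : α - 1 ≤ ξ) {μ : Fin K → ℝ}
    (hconcU : ∀ i, ∀ n : ℕ, 1 ≤ n → ∀ z : ℝ, 1 ≤ z →
      P {ω | (n : ℝ) ^ η * z ≤ (n : ℝ) * ermEst β n (fun t => x i t ω) - (n : ℝ) * μ i}
        ≤ ENNReal.ofReal (θ / z ^ ξ))
    (hconcL : ∀ i, ∀ n : ℕ, 1 ≤ n → ∀ z : ℝ, 1 ≤ z →
      P {ω | (n : ℝ) * ermEst β n (fun t => x i t ω) - (n : ℝ) * μ i ≤ -((n : ℝ) ^ η * z)}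
        ≤ ENNReal.ofReal (θ / z ^ ξ))
    {j : Fin K} {Δ : ℝ} (hΔ0 : 0 < Δ) (hΔ : ∀ i, i ≠ j → Δ ≤ μ i - μ j)
    {a : ℕ → Ω → Fin K}
    (hinit : ∀ ω, ∀ t, 1 ≤ t → t ≤ K → ((a t ω : ℕ) = t - 1))
    (hsel : ∀ ω, ∀ t, K < t → ∀ i : Fin K,
      ermEst β (pulls a (a t ω) (t - 1) ω) (fun u => x (a t ω) u ω)
          - bonus θ ξ η α t (pulls a (a t ω) (t - 1) ω)
        ≤ ermEst β (pulls a i (t - 1) ω) (fun u => x i u ω)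
          - bonus θ ξ η α t (pulls a i (t - 1) ω))
    {c : ℝ} (hc : c = 1 / (2 * (2 * R + Real.exp (2 * (β * R)) / β) * K))
    {n : ℕ} (hn : 1 ≤ n) {z : ℝ} (hz2 : 2 ≤ z) (hz : 2 ≤ c * z)
    (hzA : 2 * (2 * θ ^ (1 / ξ) / Δ) ^ (1 / (1 - η)) ≤ c * z) :
    P {ω | (n : ℝ) ^ (α / (ξ * (1 - η))) * z ≤
        |∑ i, (pulls a i n ω : ℝ) * ermEst β (pulls a i n ω) (fun t => x i t ω)
          - (n : ℝ) * μ j|}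
      ≤ ENNReal.ofReal ((2 * θ * 2 ^ ξ + 2 * K * (2 / c) ^ (α - 1)) / z ^ (α - 1)) := by
  set E := α / (ξ * (1 - η)) with hE
  set C := 2 * R + Real.exp (2 * (β * R)) / β with hC
  have hC0 : 0 < C := by positivity
  have hK : 0 < (K : ℝ) := by exact_mod_cast j.pos
  have hc0 : 0 < c := by rw [hc]; positivity
  have hn1 : (1 : ℝ) ≤ n := by exact_mod_cast hn
  have hnE : 1 ≤ (n : ℝ) ^ E := Real.one_le_rpow hn1 hη'0
  have hz0 : 0 < z := by linarith
  set w := (n : ℝ) ^ E * z with hw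
  have hzw : z ≤ w := le_mul_of_one_le_left hz0.le hnE
  have hczw : c * z ≤ c * w := by gcongr
  set u := ⌈c * w⌉₊ - 1 with hu
  have hceil := Nat.le_ceil (c * w)
  have hceil2 : 2 ≤ ⌈c * w⌉₊ := by
    have : (2 : ℝ) ≤ ⌈c * w⌉₊ := by linarith
    exact_mod_cast this
  have hu1 : 1 ≤ u := by omega
  have hucast : (u : ℝ) = ⌈c * w⌉₊ - 1 := by
    rw [hu, Nat.cast_sub (by omega), Nat.cast_one]
  have huhalf : c * w / 2 ≤ u := by rw [hucast]; linarith
  have hbonus : 2 * bonus θ ξ η α n u ≤ Δ := by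
    refine two_mul_bonus_le (by linarith) (by linarith) hη1 hΔ0 hn (le_trans ?_ huhalf)
    rw [← hE]
    have := mul_le_mul_of_nonneg_left hzA (by positivity : 0 ≤ (n : ℝ) ^ E)
    rw [hw]
    linarith
  have hsub : {ω | w ≤ |∑ i, (pulls a i n ω : ℝ) *
        ermEst β (pulls a i n ω) (fun t => x i t ω) - (n : ℝ) * μ j|} ⊆
      ({ω | (n : ℝ) ^ η * (z / 2) ≤
          (n : ℝ) * ermEst β n (fun t => x j t ω) - (n : ℝ) * μ j} ∪
        {ω | (n : ℝ) * ermEst β n (fun t => x j t ω) - (n : ℝ) * μ j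
          ≤ -((n : ℝ) ^ η * (z / 2))}) ∪
        ⋃ i ∈ Finset.univ.erase j, {ω | u < pulls a i n ω} := by
    intro ω hω
    by_contra hcon
    simp only [Set.mem_union, Set.mem_iUnion, Set.mem_ofPred_eq, not_or, not_exists,
      not_le, not_lt] at hcon hω
    obtain ⟨⟨h1, h2⟩, h3⟩ := hcon
    have hηw : (n : ℝ) ^ η * (z / 2) ≤ w / 2 := by
      have := Real.rpow_le_rpow_of_exponent_le hn1 hη'
      rw [hw, mul_div_assoc]
      gcongr
    have h4 : |(n : ℝ) * ermEst β n (fun t => x j t ω) - (n : ℝ) * μ j| < w / 2 := by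
      rw [abs_lt]
      constructor <;> linarith
    have h5 := abs_sum_pulls_mul_ermEst_sub_le hR.le hβ (fun i t => hxbdd i t ω) a j n
    rw [← hC] at h5
    have h6 : ∑ i ∈ Finset.univ.erase j, (pulls a i n ω : ℝ) ≤ K * (c * w) := by
      have h := Finset.sum_le_card_nsmul (Finset.univ.erase j) (fun i => (pulls a i n ω : ℝ))
        (c * w) fun i hi => by
          have h7 : (pulls a i n ω : ℝ) ≤ u := by exact_mod_cast h3 i hi
          have := Nat.ceil_lt_add_one (show 0 ≤ c * w by positivity)
          linarith
      rw [nsmul_eq_mul] at h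
      refine h.trans ?_
      have h8 : ((Finset.univ.erase j).card : ℝ) ≤ K := by
        have := Finset.card_le_univ (Finset.univ.erase j)
        rw [Fintype.card_fin] at this
        exact_mod_cast this
      gcongr
    have h9 : C * (K * (c * w)) = w / 2 := by
      rw [hc]; field_simp
    have h10 := mul_le_mul_of_nonneg_left h6 hC0.le
    have h11 := abs_sub_le (∑ i, (pulls a i n ω : ℝ) *
        ermEst β (pulls a i n ω) (fun t => x i t ω))
        ((n : ℝ) * ermEst β n (fun t => x j t ω)) ((n : ℝ) * μ j)
    linarith
  have hU := hconcU j n hn (z / 2) (by linarith)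
  have hL := hconcL j n hn (z / 2) (by linarith)
  have hT : P (⋃ i ∈ Finset.univ.erase j, {ω | u < pulls a i n ω})
      ≤ ENNReal.ofReal (K * (2 / (u : ℝ) ^ (α - 1))) := by
    refine (measure_biUnion_finset_le _ _).trans ((Finset.sum_le_card_nsmul _ _ _
      fun i hi => measure_lt_pulls_le hθ hξ hα2 hconcU hconcL hinit hsel
        (Finset.ne_of_mem_erase hi) hu1
        (hbonus.trans (hΔ i (Finset.ne_of_mem_erase hi)))).trans ?_)
    rw [nsmul_eq_mul, ENNReal.ofReal_mul hK.le, ENNReal.ofReal_natCast]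
    gcongr
    exact (Finset.card_le_univ _).trans_eq (Fintype.card_fin K)
  refine (measure_mono hsub).trans ((measure_union_le _ _).trans
    ((add_le_add ((measure_union_le _ _).trans (add_le_add hU hL)) hT).trans ?_))
  rw [← ENNReal.ofReal_add (by positivity) (by positivity),
    ← ENNReal.ofReal_add (by positivity) (by positivity)]
  apply ENNReal.ofReal_le_ofReal
  have hfirst : θ / (z / 2) ^ ξ ≤ θ * 2 ^ ξ / z ^ (α - 1) := by
    rw [Real.div_rpow hz0.le (by norm_num), div_div_eq_mul_div]
    have := Real.rpow_le_rpow_of_exponent_le (by linarith : 1 ≤ z) hαξ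
    gcongr
  have hsecond : K * (2 / (u : ℝ) ^ (α - 1)) ≤ 2 * K * (2 / c) ^ (α - 1) / z ^ (α - 1) := by
    have h1 : (z / (2 / c)) ^ (α - 1) ≤ (u : ℝ) ^ (α - 1) := by
      refine Real.rpow_le_rpow (by positivity) ?_ (by linarith)
      have : z / (2 / c) = c * z / 2 := by field_simp
      linarith
    rw [Real.div_rpow hz0.le (by positivity)] at h1
    calc K * (2 / (u : ℝ) ^ (α - 1)) ≤ K * (2 / (z ^ (α - 1) / (2 / c) ^ (α - 1))) := by gcongr
      _ = _ := by field_simp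
  rw [add_div]
  have e : 2 * θ * 2 ^ ξ / z ^ (α - 1)
      = θ * 2 ^ ξ / z ^ (α - 1) + θ * 2 ^ ξ / z ^ (α - 1) := by ring
  linarith

/-- polynomial concentration of the empirical ERM_β
`ρ̄_n = (1/n) Σ_i T_i(n) ρ̂_{i,T_i(n)}` of the UCB-ERM algorithm on a non-stationary
`K`-armed bandit satisfying Assumption A2, at exponents `η' = α/(ξ(1−η))`, `ξ' = α − 1`,
for some constant `θ' > 1`; moreover `1/2 ≤ η' < 1` and `ξ' > 1`. -/
theorem stmt6 {Ω : Type*} [MeasurableSpace Ω] (P : Measure Ω) [IsProbabilityMeasure P]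
    (K : ℕ) (hK : 1 ≤ K) (R β : ℝ) (hR : 0 < R) (hβ : 0 < β)
    (x : Fin K → ℕ → Ω → ℝ) (hxmeas : ∀ i t, Measurable (x i t))
    (hxbdd : ∀ i t ω, x i t ω ∈ Set.Icc (-R) R)
    (θ ξ η α : ℝ) (hθ : 1 < θ) (hξ : 1 < ξ) (hη : 1 / 2 ≤ η) (hη1 : η < 1)
    (hα2 : 2 < α) (hαl : ξ * η * (1 - η) ≤ α) (hαu : α < ξ * (1 - η))
    (μ : Fin K → ℝ)
    (hconv : ∀ i, Tendsto (fun n => ∫ ω, ermEst β n (fun t => x i t ω) ∂P) atTop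
      (nhds (μ i)))
    (hconcU : ∀ i, ∀ n : ℕ, 1 ≤ n → ∀ z : ℝ, 1 ≤ z →
      P {ω | (n : ℝ) ^ η * z ≤ (n : ℝ) * ermEst β n (fun t => x i t ω) - (n : ℝ) * μ i}
        ≤ ENNReal.ofReal (θ / z ^ ξ))
    (hconcL : ∀ i, ∀ n : ℕ, 1 ≤ n → ∀ z : ℝ, 1 ≤ z →
      P {ω | (n : ℝ) * ermEst β n (fun t => x i t ω) - (n : ℝ) * μ i ≤ -((n : ℝ) ^ η * z)}
        ≤ ENNReal.ofReal (θ / z ^ ξ))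
    (istar : Fin K) (hstar : ∀ i, i ≠ istar → μ istar < μ i)
    (Δmin : ℝ) (hΔ : IsLeast {d | ∃ i, i ≠ istar ∧ d = μ i - μ istar} Δmin)
    (a : ℕ → Ω → Fin K) (hameas : ∀ t, Measurable (a t))
    (hinit : ∀ ω, ∀ t, 1 ≤ t → t ≤ K → ((a t ω : ℕ) = t - 1))
    (hsel : ∀ ω, ∀ t, K < t → ∀ i : Fin K,
      ermEst β (pulls a (a t ω) (t - 1) ω) (fun u => x (a t ω) u ω)
          - bonus θ ξ η α t (pulls a (a t ω) (t - 1) ω)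
        ≤ ermEst β (pulls a i (t - 1) ω) (fun u => x i u ω)
          - bonus θ ξ η α t (pulls a i (t - 1) ω)) :
    (1 / 2 ≤ α / (ξ * (1 - η)) ∧ α / (ξ * (1 - η)) < 1 ∧ 1 < α - 1) ∧
    ∃ θ' : ℝ, 1 < θ' ∧
      ∀ n : ℕ, 1 ≤ n → ∀ z : ℝ, 1 ≤ z →
        P {ω | (n : ℝ) ^ (α / (ξ * (1 - η))) * z ≤
              (n : ℝ) * ((1 / (n : ℝ)) * ∑ i, (pulls a i n ω : ℝ) *
                  ermEst β (pulls a i n ω) (fun t => x i t ω))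
                - (n : ℝ) * μ istar}
          ≤ ENNReal.ofReal (θ' / z ^ (α - 1)) ∧
        P {ω | (n : ℝ) * ((1 / (n : ℝ)) * ∑ i, (pulls a i n ω : ℝ) *
                  ermEst β (pulls a i n ω) (fun t => x i t ω))
                - (n : ℝ) * μ istar ≤ -((n : ℝ) ^ (α / (ξ * (1 - η))) * z)}
          ≤ ENNReal.ofReal (θ' / z ^ (α - 1)) := by
  have hγ : 0 < 1 - η := by linarith
  have hξγ : 0 < ξ * (1 - η) := by positivity
  have hη' : η ≤ α / (ξ * (1 - η)) := by
    rw [le_div_iff₀ hξγ]; linarith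
  refine ⟨⟨hη.trans hη', (div_lt_one hξγ).2 hαu, by linarith⟩, ?_⟩
  obtain ⟨⟨i₀, hi₀, hΔi₀⟩, hΔlb⟩ := hΔ
  have hΔ0 : 0 < Δmin := by have := hstar i₀ hi₀; linarith
  have hΔle : ∀ i, i ≠ istar → Δmin ≤ μ i - μ istar := fun i hi => hΔlb ⟨i, hi, rfl⟩
  have hαξ : α - 1 ≤ ξ := by nlinarith
  have hK0 : (0 : ℝ) < K := by exact_mod_cast hK
  obtain ⟨c, hc⟩ : ∃ c : ℝ, c = 1 / (2 * (2 * R + Real.exp (2 * (β * R)) / β) * K) := ⟨_, rfl⟩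
  have hc0 : 0 < c := by rw [hc]; positivity
  set A := 2 * (2 * θ ^ (1 / ξ) / Δmin) ^ (1 / (1 - η)) with hA
  have hA0 : 0 < A := by positivity
  set z₀ := 2 + 2 / c + A / c with hz₀
  have hz₀pos : 0 < z₀ := by positivity
  have hz₀p : 0 < z₀ ^ (α - 1) := by positivity
  set D := 2 * θ * 2 ^ ξ + 2 * K * (2 / c) ^ (α - 1) with hD
  have hD0 : 0 < D := by positivity
  have key : ∀ n : ℕ, 1 ≤ n → ∀ z : ℝ, 1 ≤ z →
      P {ω | (n : ℝ) ^ (α / (ξ * (1 - η))) * z ≤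
        |∑ i, (pulls a i n ω : ℝ) * ermEst β (pulls a i n ω) (fun t => x i t ω)
          - (n : ℝ) * μ istar|}
      ≤ ENNReal.ofReal ((1 + D + z₀ ^ (α - 1)) / z ^ (α - 1)) := by
    intro n hn z hz
    have hz0 : 0 < z := by linarith
    rcases le_total z z₀ with hle | hge
    · refine prob_le_one.trans ?_
      rw [ENNReal.one_le_ofReal, one_le_div (by positivity)]
      have := Real.rpow_le_rpow hz0.le hle (by linarith : 0 ≤ α - 1)
      linarith
    · have h1 : c * z₀ = 2 * c + 2 + A := by rw [hz₀]; field_simp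
      have h2 : c * z₀ ≤ c * z := by gcongr
      have h3 : 0 < 2 / c := by positivity
      have h4 : 0 < A / c := by positivity
      refine (measure_le_abs_sum_sub_le hR hβ hxbdd hθ hξ hη1 hα2 hη' (by linarith) hαξ
        hconcU hconcL hΔ0 hΔle hinit hsel hc hn (by linarith) (by linarith)
        (by linarith)).trans (ENNReal.ofReal_le_ofReal ?_)
      rw [← hD]
      gcongr
      linarith
  refine ⟨1 + D + z₀ ^ (α - 1), by linarith, fun n hn z hz => ?_⟩
  have hn0 : (n : ℝ) ≠ 0 := by positivity
  simp only [← mul_assoc, mul_one_div_cancel hn0, one_mul]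
  refine ⟨(measure_mono fun ω hω => ?_).trans (key n hn z hz),
    (measure_mono fun ω hω => ?_).trans (key n hn z hz)⟩
  · rw [Set.mem_ofPred_eq] at hω ⊢
    exact hω.trans (le_abs_self _)
  · rw [Set.mem_ofPred_eq] at hω ⊢
    exact (le_neg_of_le_neg hω).trans (neg_le_abs _)
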